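/- For every subspace L ⊆ V and every alternating linear map F : V → V*, the subspace W_{L,F} = {x ⊕ (F(x) + ξ) : x ∈ L, ξ ∈ Ann L} of V ⊕ V* is maximally isotropic (it has dimension n and q vanishes identically on it), its intersection with {0} ⊕ V* equals Ann L, and it depends only on the restriction of F to L: for alternating F, F' : V → V*, W_{L,F} = W_{L,F'} if and only if F(x)(y) = F'(x)(y) for all x, y ∈ L. -/

import Mathlib

noncomputable section

variable {V : Type*} [AddCommGroup V] [Module ℝ V] [FiniteDimensional ℝ V]

/-- The natural symmetric bilinear pairing `q(x ⊕ ξ, y ⊕ η) = (ξ(y) + η(x))/2` of signature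
`(n, n)` on `V ⊕ V*`. -/
def gq (p p' : V × Module.Dual ℝ V) : ℝ := (p.2 p'.1 + p'.2 p.1) / 2

/-- A linear map `V → V*` is alternating if `F(x)(x) = 0` for all `x`; equivalently, it is a
2-form. -/
def IsAltMap (F : V →ₗ[ℝ] Module.Dual ℝ V) : Prop := ∀ x, F x x = 0

/-- The shear `x ⊕ ξ ↦ x ⊕ (F(x) + ξ)` of `V ⊕ V*` determined by `F : V → V*` (for alternating
`F` this is the `B`-field transformation `e_F`). -/
def shear (F : V →ₗ[ℝ] Module.Dual ℝ V) :
    (V × Module.Dual ℝ V) →ₗ[ℝ] (V × Module.Dual ℝ V) :=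
  (LinearMap.fst ℝ V (Module.Dual ℝ V)).prod
    (F ∘ₗ LinearMap.fst ℝ V (Module.Dual ℝ V) + LinearMap.snd ℝ V (Module.Dual ℝ V))

/-- The subspace `W_{L,F} = {x ⊕ (F(x) + ξ) : x ∈ L, ξ ∈ Ann L}` of `V ⊕ V*` attached to a
subspace `L ⊆ V` and an alternating map `F : V → V*`. -/
def WLF (L : Submodule ℝ V) (F : V →ₗ[ℝ] Module.Dual ℝ V) :
    Submodule ℝ (V × Module.Dual ℝ V) :=
  (L.prod L.dualAnnihilator).map (shear F)

/-- A subspace `W ⊆ V ⊕ V*` is maximally isotropic if it has dimension `n = dim V` and the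
pairing `q` vanishes identically on it. -/
def MaxIsotropic (W : Submodule ℝ (V × Module.Dual ℝ V)) : Prop :=
  Module.finrank ℝ W = Module.finrank ℝ V ∧ ∀ p ∈ W, ∀ p' ∈ W, gq p p' = 0

theorem mem_WLF_iff' (L : Submodule ℝ V) (F : V →ₗ[ℝ] Module.Dual ℝ V)
    (p : V × Module.Dual ℝ V) :
    p ∈ WLF L F ↔ p.1 ∈ L ∧ p.2 - F p.1 ∈ L.dualAnnihilator := by
  unfold WLF
  rw [Submodule.mem_map]
  constructor
  · rintro ⟨⟨x, ξ⟩, ⟨hx, hξ⟩, rfl⟩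
    refine ⟨hx, ?_⟩
    have : (shear F (x, ξ)).2 - F (shear F (x, ξ)).1 = ξ := by simp [shear]
    rw [this]; exact hξ
  · rintro ⟨h1, h2⟩
    refine ⟨(p.1, p.2 - F p.1), ⟨h1, h2⟩, ?_⟩
    ext <;> simp [shear]

theorem alt_swap' (F : V →ₗ[ℝ] Module.Dual ℝ V) (hF : IsAltMap F) (x y : V) :
    F x y + F y x = 0 := by
  have h := hF (x + y)
  have h1 := hF x
  have h2 := hF y
  simp only [map_add, LinearMap.add_apply] at h
  linarith

theorem shear_inj' (F : V →ₗ[ℝ] Module.Dual ℝ V) : Function.Injective (shear F) := by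
  rintro ⟨x, ξ⟩ ⟨y, η⟩ h
  have h1 : x = y := congrArg Prod.fst h
  have h2 : F x + ξ = F y + η := congrArg Prod.snd h
  subst h1
  rw [add_left_cancel h2]

/-- The product of two subspaces is the direct product of the underlying spaces. -/
def prodSubEquiv (L : Submodule ℝ V) (M : Submodule ℝ (Module.Dual ℝ V)) :
    L.prod M ≃ₗ[ℝ] L × M where
  toFun p := (⟨p.1.1, p.2.1⟩, ⟨p.1.2, p.2.2⟩)
  invFun p := ⟨(p.1.1, p.2.1), p.1.2, p.2.2⟩
  map_add' _ _ := rfl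
  map_smul' _ _ := rfl
  left_inv _ := rfl
  right_inv _ := rfl

theorem finrank_WLF' (L : Submodule ℝ V) (F : V →ₗ[ℝ] Module.Dual ℝ V) :
    Module.finrank ℝ (WLF L F) = Module.finrank ℝ V := by
  unfold WLF
  haveI : Module.Free ℝ L.dualAnnihilator :=
    Module.Free.of_divisionRing ℝ L.dualAnnihilator
  rw [← LinearEquiv.finrank_eq (Submodule.equivMapOfInjective (shear F) (shear_inj' F) _),
    LinearEquiv.finrank_eq (prodSubEquiv L L.dualAnnihilator),
    Module.finrank_prod]
  exact Subspace.finrank_add_finrank_dualAnnihilator_eq L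

/-- For every subspace `L ⊆ V` and alternating `F : V → V*`, the subspace
`W_{L,F}` of `V ⊕ V*` is maximally isotropic, its intersection with `{0} ⊕ V*` is the
annihilator of `L`, and it depends only on the restriction of `F` to `L`. -/
theorem WLF_maxIsotropic (L : Submodule ℝ V) (F F' : V →ₗ[ℝ] Module.Dual ℝ V)
    (hF : IsAltMap F) (hF' : IsAltMap F') :
    MaxIsotropic (WLF L F) ∧
    (∀ ξ : Module.Dual ℝ V, ((0 : V), ξ) ∈ WLF L F ↔ ξ ∈ L.dualAnnihilator) ∧
    (WLF L F = WLF L F' ↔ ∀ x ∈ L, ∀ y ∈ L, F x y = F' x y) := by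
  refine ⟨⟨finrank_WLF' L F, ?_⟩, ?_, ?_⟩
  · intro p hp p' hp'
    rw [mem_WLF_iff'] at hp hp'
    have h1 := (Submodule.mem_dualAnnihilator _).1 hp.2 _ hp'.1
    have h2 := (Submodule.mem_dualAnnihilator _).1 hp'.2 _ hp.1
    have h3 := alt_swap' F hF p.1 p'.1
    simp only [LinearMap.sub_apply] at h1 h2
    unfold gq
    linarith
  · intro ξ
    rw [mem_WLF_iff']
    simp
  · constructor
    · intro h x hx y hy
      have h1 : (x, F x) ∈ WLF L F := by
        rw [mem_WLF_iff']; simp [hx]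
      rw [h, mem_WLF_iff'] at h1
      have h2 := (Submodule.mem_dualAnnihilator _).1 h1.2 _ hy
      simp only [LinearMap.sub_apply] at h2
      linarith
    · intro h
      ext p
      rw [mem_WLF_iff', mem_WLF_iff']
      refine and_congr_right fun hp => ?_
      simp only [Submodule.mem_dualAnnihilator, LinearMap.sub_apply]
      refine forall₂_congr fun y hy => ?_
      rw [h _ hp _ hy]
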